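/- arXiv:math/0506618 — 8 statements merged into one kernel-verified Lean document; each statement's English description precedes it below -/
import Mathlib

section
/- For all integers m ≥ 3 and n ≥ 0, with N = 2(3^{m−1} + 2n − 1), the 2m−1 entries i+b_1, i+b_2, …, i+b_{2m−3}, i+b_{2m−2}+n, i+b_{2m−1}+2n of the face F_i are pairwise distinct elements of ℤ/Nℤ for every i ∈ ℤ/Nℤ; that is, each face F_i is a genuine (2m−1)-cycle. -/
/-- The sequence `b` : `b (2l-1) = 3^(l-1) - 1`, `b (2l) = 2·3^(l-1) - 1` (for `k ≥ 1`). -/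
def bseq (k : ℕ) : ℤ := if k % 2 = 1 then 3 ^ (k / 2) - 1 else 2 * 3 ^ (k / 2 - 1) - 1

/-- Offsets of the face `F_i` in the odd case `M_{2m-1, 2(3^{m-1}+2n-1)}`:
the `k`-th offset (for `1 ≤ k ≤ 2m-1`) is `b_k`, except `b_{2m-2} + n` and `b_{2m-1} + 2n`. -/
def oddOff (m n k : ℕ) : ℤ :=
  bseq k + (if k = 2 * m - 2 then (n : ℤ) else if k = 2 * m - 1 then 2 * (n : ℤ) else 0)

/-- The entries of the face `F_i` (odd case): the `j`-th entry (`j = 0, …, 2m-2`)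
is `i + b_{j+1}` with the modifications for the last two entries, in `ℤ/Nℤ`,
`N = 2(3^{m-1}+2n-1)`. -/
def Fface (m n : ℕ) (i : ZMod (2 * (3 ^ (m - 1) + 2 * n - 1))) :
    Fin (2 * m - 1) → ZMod (2 * (3 ^ (m - 1) + 2 * n - 1)) :=
  fun j => i + (oddOff m n (j.1 + 1) : ZMod (2 * (3 ^ (m - 1) + 2 * n - 1)))

theorem bseq_lt_succ (k : ℕ) (hk : 1 ≤ k) : bseq k < bseq (k + 1) := by
  obtain ⟨l, rfl | rfl⟩ : ∃ l, k = 2 * l + 1 ∨ k = 2 * l + 2 := ⟨(k - 1) / 2, by omega⟩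
  · have hpos : (0 : ℤ) < 3 ^ l := by positivity
    have hodd : bseq (2 * l + 1) = 3 ^ l - 1 := by
      rw [bseq, if_pos (by omega), show (2 * l + 1) / 2 = l by omega]
    have heven : bseq (2 * l + 1 + 1) = 2 * 3 ^ l - 1 := by
      rw [bseq, if_neg (by omega), show (2 * l + 1 + 1) / 2 - 1 = l by omega]
    linarith
  · have hpos : (0 : ℤ) < 3 ^ l := by positivity
    have heven : bseq (2 * l + 2) = 2 * 3 ^ l - 1 := by
      rw [bseq, if_neg (by omega), show (2 * l + 2) / 2 - 1 = l by omega]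
    have hodd : bseq (2 * l + 2 + 1) = 3 * 3 ^ l - 1 := by
      rw [bseq, if_pos (by omega), show (2 * l + 2 + 1) / 2 = l + 1 by omega, pow_succ']
    linarith

theorem oddOff_lt_succ (m n k : ℕ) (hk : 1 ≤ k) (hkm : k + 1 ≤ 2 * m - 1) :
    oddOff m n k < oddOff m n (k + 1) := by
  have := bseq_lt_succ k hk
  unfold oddOff
  split_ifs <;> omega

theorem oddOff_lt_oddOff (m n : ℕ) {j k : ℕ} (hj : 1 ≤ j) (hjk : j < k)
    (hk : k ≤ 2 * m - 1) : oddOff m n j < oddOff m n k := by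
  induction k, hjk using Nat.le_induction with
  | base => exact oddOff_lt_succ m n j hj hk
  | succ k hjk ih => exact (ih (by omega)).trans (oddOff_lt_succ m n k (by omega) hk)

theorem oddOff_one (m n : ℕ) (hm : 2 ≤ m) : oddOff m n 1 = 0 := by
  rw [oddOff, if_neg (by omega), if_neg (by omega)]
  simp [bseq]

theorem oddOff_last (m n : ℕ) (hm : 1 ≤ m) :
    oddOff m n (2 * m - 1) = 3 ^ (m - 1) - 1 + 2 * n := by
  rw [oddOff, if_neg (by omega), if_pos rfl, bseq, if_pos (by omega),
    show (2 * m - 1) / 2 = m - 1 by omega]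

/-- The offsets at positions `j < k` differ by a positive integer smaller than `N`, so they stay
distinct modulo `N`. -/
theorem oddOff_cast_ne (m n : ℕ) (hm : 2 ≤ m) {j k : ℕ} (hj : 1 ≤ j) (hjk : j < k)
    (hk : k ≤ 2 * m - 1) :
    (oddOff m n j : ZMod (2 * (3 ^ (m - 1) + 2 * n - 1))) ≠ oddOff m n k := by
  intro h
  have hdvd := (ZMod.intCast_eq_intCast_iff_dvd_sub _ _ _).1 h
  have hlt := oddOff_lt_oddOff m n hj hjk hk
  have hle := Int.le_of_dvd (by linarith) hdvd
  have hlow : 0 ≤ oddOff m n j := by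
    rw [← oddOff_one m n hm]
    rcases hj.eq_or_lt with rfl | hj
    · rfl
    · exact (oddOff_lt_oddOff m n le_rfl hj (by omega)).le
  have hhigh : oddOff m n k ≤ 3 ^ (m - 1) - 1 + 2 * n := by
    rw [← oddOff_last m n (by omega)]
    rcases hk.eq_or_lt with rfl | hk
    · rfl
    · exact (oddOff_lt_oddOff m n (by omega) hk le_rfl).le
  have hone : 1 ≤ 3 ^ (m - 1) + 2 * n := 
    (Nat.one_le_pow _ 3 (by norm_num)).trans (Nat.le_add_right _ _)
  push_cast [Nat.cast_sub hone] at hle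
  linarith

/-- for `m ≥ 3`, `n ≥ 0`, the `2m-1` entries of each face `F_i` are pairwise
distinct elements of `ℤ/Nℤ`, `N = 2(3^{m-1}+2n-1)`; i.e. `F_i` is a genuine `(2m-1)`-cycle. -/
theorem Fface_entries_pairwise_distinct (m n : ℕ) (hm : 3 ≤ m)
    (i : ZMod (2 * (3 ^ (m - 1) + 2 * n - 1))) :
    Function.Injective (Fface m n i) := by
  intro j k h
  have hcast := add_left_cancel h
  by_contra hne
  rcases lt_or_gt_of_ne (Fin.val_ne_of_ne hne) with hlt | hlt
  · exact oddOff_cast_ne m n (by omega) (by omega) (by omega) (by omega) hcast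
  · exact oddOff_cast_ne m n (by omega) (by omega) (by omega) (by omega) hcast.symm
end

section
/- For all integers m ≥ 3 and n ≥ 0, with η = 3^m + 2n − 1, the 2m entries i+b_1, i+b_2, …, i+b_{2m−1}, i+b_{2m}+n of the face C_i are pairwise distinct elements of ℤ/ηℤ for every i ∈ ℤ/ηℤ; that is, each face C_i is a genuine (2m)-cycle. -/
/-- Offsets of the face `C_i` in the even case `M_{2m, 3^m+2n-1}`:
the `k`-th offset (for `1 ≤ k ≤ 2m`) is `b_k`, except the last one which is `b_{2m} + n`. -/
def evenOff (m n k : ℕ) : ℤ := bseq k + (if k = 2 * m then (n : ℤ) else 0)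

/-- The entries of the face `C_i` (even case): the `j`-th entry (`j = 0, …, 2m-1`)
is `i + b_{j+1}`, with the last entry `i + b_{2m} + n`, in `ℤ/ηℤ`, `η = 3^m + 2n - 1`. -/
def Cface (m n : ℕ) (i : ZMod (3 ^ m + 2 * n - 1)) :
    Fin (2 * m) → ZMod (3 ^ m + 2 * n - 1) :=
  fun j => i + (evenOff m n (j.1 + 1) : ZMod (3 ^ m + 2 * n - 1))

theorem bseq_succ_strictMono : StrictMono fun j : ℕ => bseq (j + 1) := by
  refine strictMono_nat_of_lt_succ fun j => ?_
  obtain ⟨l, rfl | rfl⟩ := Nat.even_or_odd' j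
  · have h3 : (0 : ℤ) < 3 ^ l := by positivity
    simp only [bseq, show (2 * l + 1) % 2 = 1 by lia, show ¬(2 * l + 1 + 1) % 2 = 1 by lia,
      show (2 * l + 1) / 2 = l by lia, show (2 * l + 1 + 1) / 2 - 1 = l by lia, if_true, if_false]
    linarith
  · have h3 : (0 : ℤ) < 3 ^ l := by positivity
    simp only [bseq, show ¬(2 * l + 1 + 1) % 2 = 1 by lia,
      show (2 * l + 1 + 1 + 1) % 2 = 1 by lia, show (2 * l + 1 + 1) / 2 - 1 = l by lia,
      show (2 * l + 1 + 1 + 1) / 2 = l + 1 by lia, if_true, if_false, pow_succ]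
    linarith

theorem evenOff_succ_strictMonoOn (m n : ℕ) :
    StrictMonoOn (fun j : ℕ => evenOff m n (j + 1)) (Set.Iio (2 * m)) := by
  intro a _ b hb hab
  have hlt : bseq (a + 1) < bseq (b + 1) := bseq_succ_strictMono hab
  have ha : a + 1 ≠ 2 * m := by
    have : b < 2 * m := hb
    lia
  simp only [evenOff, if_neg ha]
  split_ifs <;> lia

theorem evenOff_succ_nonneg (m n j : ℕ) : 0 ≤ evenOff m n (j + 1) := by
  have h : bseq (0 + 1) ≤ bseq (j + 1) := bseq_succ_strictMono.monotone (Nat.zero_le j)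
  have h1 : bseq (0 + 1) = 0 := by simp [bseq]
  unfold evenOff
  split_ifs <;> lia

theorem evenOff_succ_lt (m n j : ℕ) (hj : j < 2 * m) :
    evenOff m n (j + 1) < 3 ^ m + 2 * n - 1 := by
  obtain ⟨l, rfl⟩ : ∃ l, m = l + 1 := ⟨m - 1, by lia⟩
  have h : bseq (j + 1) ≤ bseq (2 * l + 1 + 1) :=
    bseq_succ_strictMono.monotone (by lia : j ≤ 2 * l + 1)
  have hlast : bseq (2 * l + 1 + 1) = 2 * 3 ^ l - 1 := by
    simp only [bseq, show ¬(2 * l + 1 + 1) % 2 = 1 by lia,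
      show (2 * l + 1 + 1) / 2 - 1 = l by lia, if_false]
  have h3 : (0 : ℤ) < 3 ^ l := by positivity
  rw [pow_succ]
  unfold evenOff
  split_ifs <;> linarith

/-- for `m ≥ 3`, `n ≥ 0`, the `2m` entries of each face `C_i` are pairwise
distinct elements of `ℤ/ηℤ`, `η = 3^m + 2n - 1`; i.e. `C_i` is a genuine `2m`-cycle. -/
theorem Cface_entries_pairwise_distinct (m n : ℕ) (hm : 3 ≤ m)
    (i : ZMod (3 ^ m + 2 * n - 1)) :
    Function.Injective (Cface m n i) := by
  intro a b hab
  have hcast : ((3 ^ m + 2 * n - 1 : ℕ) : ℤ) = 3 ^ m + 2 * n - 1 := by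
    have : 0 < 3 ^ m := by positivity
    push_cast [Nat.cast_sub (show 1 ≤ 3 ^ m + 2 * n by lia)]
    rfl
  have hmod := (ZMod.intCast_eq_intCast_iff _ _ _).mp (add_left_cancel hab)
  rw [Int.ModEq, hcast,
    Int.emod_eq_of_lt (evenOff_succ_nonneg m n a) (evenOff_succ_lt m n a a.2),
    Int.emod_eq_of_lt (evenOff_succ_nonneg m n b) (evenOff_succ_lt m n b b.2)] at hmod
  exact Fin.ext ((evenOff_succ_strictMonoOn m n).injOn a.2 b.2 hmod)
end

section
/- For all integers m ≥ 3 and n ≥ 0, with η = 3^m + 2n − 1: every 2-element subset of ℤ/ηℤ that occurs as an edge of some face C_i occurs as an edge of exactly two of the faces C_j (j ∈ ℤ/ηℤ); consequently the total number of distinct 2-element subsets occurring as edges of faces equals (3^m + 2n − 1)·m, and the Euler characteristic f_0 − f_1 + f_2 — where f_0 = η is the number of vertices, f_1 is the number of distinct edges, and f_2 = η is the number of faces — equals (3^m + 2n − 1)(2 − m). -/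
/-- `e` is an edge of the face `C_j`: a set of two cyclically consecutive entries. -/
def IsCedge (m n : ℕ) (j : ZMod (3 ^ m + 2 * n - 1))
    (e : Set (ZMod (3 ^ m + 2 * n - 1))) : Prop :=
  ∃ t : Fin (2 * m), e = {Cface m n j t, Cface m n j (finRotate (2 * m) t)}

/-- The `l`-th step length of a face; each of them occurs twice around the face. -/
def stepLen (m n l : ℕ) : ℕ := 3 ^ l + if l + 1 = m then n else 0

lemma stepLen_pos (m n l : ℕ) : 0 < stepLen m n l := by
  unfold stepLen; positivity

lemma two_mul_stepLen_lt {m n l : ℕ} (hm : 3 ≤ m) (hl : l < m) :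
    2 * stepLen m n l < 3 ^ m + 2 * n - 1 := by
  obtain ⟨k, rfl⟩ : ∃ k, m = k + 1 := ⟨m - 1, by omega⟩
  have h1 : 3 ^ l ≤ 3 ^ k := Nat.pow_le_pow_right (by norm_num) (by omega)
  have h2 : 3 ^ 2 ≤ 3 ^ k := Nat.pow_le_pow_right (by norm_num) (by omega)
  unfold stepLen
  rw [pow_succ]
  split_ifs <;> omega

lemma stepLen_lt_stepLen {m n l k : ℕ} (hlk : l < k) (hk : k < m) :
    stepLen m n l < stepLen m n k := by
  have h : 3 ^ l < 3 ^ k := Nat.pow_lt_pow_right (by norm_num) hlk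
  unfold stepLen
  split_ifs <;> omega

lemma stepLen_injective (m n : ℕ) : Function.Injective fun l : Fin m => stepLen m n l :=
  StrictMono.injective fun _ k h => stepLen_lt_stepLen h k.2

lemma natCast_stepLen_injective {m n : ℕ} (hm : 3 ≤ m) :
    Function.Injective fun l : Fin m => (stepLen m n l : ZMod (3 ^ m + 2 * n - 1)) := by
  intro l k h
  have hl := two_mul_stepLen_lt (n := n) hm l.2
  have hk := two_mul_stepLen_lt (n := n) hm k.2
  simp only [ZMod.natCast_eq_natCast_iff'] at h
  rw [Nat.mod_eq_of_lt (by omega), Nat.mod_eq_of_lt (by omega)] at h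
  exact stepLen_injective m n h

lemma natCast_stepLen_add_ne_zero {m n : ℕ} (hm : 3 ≤ m) (l k : Fin m) :
    (stepLen m n l + stepLen m n k : ZMod (3 ^ m + 2 * n - 1)) ≠ 0 := by
  have hl := two_mul_stepLen_lt (n := n) hm l.2
  have hk := two_mul_stepLen_lt (n := n) hm k.2
  have hp := stepLen_pos m n l
  rw [← Nat.cast_add, Ne, ZMod.natCast_eq_zero_iff]
  intro h
  have := Nat.le_of_dvd (by omega) h
  omega

lemma natCast_stepLen_ne_zero {m n : ℕ} (hm : 3 ≤ m) (l : Fin m) :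
    (stepLen m n l : ZMod (3 ^ m + 2 * n - 1)) ≠ 0 := fun h =>
  natCast_stepLen_add_ne_zero (n := n) hm l l (by rw [h, add_zero])

lemma bseq_odd (l : ℕ) : bseq (2 * l + 1) = 3 ^ l - 1 := by
  have h1 : (2 * l + 1) % 2 = 1 := by omega
  have h2 : (2 * l + 1) / 2 = l := by omega
  rw [bseq, if_pos h1, h2]

lemma bseq_even (l : ℕ) : bseq (2 * l + 2) = 2 * 3 ^ l - 1 := by
  have h1 : ¬ (2 * l + 2) % 2 = 1 := by omega
  have h2 : (2 * l + 2) / 2 - 1 = l := by omega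
  rw [bseq, if_neg h1, h2]

lemma evenOff_odd (m n l : ℕ) : evenOff m n (2 * l + 1) = 3 ^ l - 1 := by
  rw [evenOff, bseq_odd, if_neg (by omega), add_zero]

lemma evenOff_even (m n l : ℕ) :
    evenOff m n (2 * l + 2) = evenOff m n (2 * l + 1) + stepLen m n l := by
  rw [evenOff_odd, evenOff, bseq_even, stepLen]
  have : 2 * l + 2 = 2 * m ↔ l + 1 = m := by omega
  simp only [this]
  push_cast
  ring

lemma evenOff_even_add_stepLen {m n l : ℕ} (hl : l + 1 < m) :
    evenOff m n (2 * l + 2) + stepLen m n l = evenOff m n (2 * l + 3) := by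
  rw [evenOff_even, evenOff_odd, show 2 * l + 3 = 2 * (l + 1) + 1 by ring, evenOff_odd, stepLen,
    if_neg (by omega)]
  push_cast
  ring

lemma evenOff_last_add_stepLen (n l : ℕ) :
    evenOff (l + 1) n (2 * l + 2) + stepLen (l + 1) n l = (3 ^ (l + 1) + 2 * n - 1 : ℕ) := by
  have : 1 ≤ 3 ^ (l + 1) := Nat.one_le_pow _ _ (by norm_num)
  rw [evenOff_even, evenOff_odd, stepLen, if_pos rfl, Nat.cast_sub (by omega)]
  push_cast
  ring

lemma coe_finRotate_eq_mod (n : ℕ) (t : Fin n) : (finRotate n t : ℕ) = (t + 1) % n := by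
  cases n with
  | zero => exact t.elim0
  | succ n => simp [Fin.val_add]

/-- The pair `{x, x + d}`, where `d` is the `l`-th step length. -/
def stepPair (m n : ℕ) (p : ZMod (3 ^ m + 2 * n - 1) × Fin m) :
    Set (ZMod (3 ^ m + 2 * n - 1)) :=
  {p.1, p.1 + stepLen m n p.2}

lemma stepPair_injective {m n : ℕ} (hm : 3 ≤ m) : Function.Injective (stepPair m n) := by
  rintro ⟨x, l⟩ ⟨y, k⟩ h
  rcases Set.pair_eq_pair_iff.1 h with ⟨h1, h2⟩ | ⟨h1, h2⟩ <;> dsimp only at h1 h2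
  · subst h1
    rw [natCast_stepLen_injective hm (add_left_cancel h2)]
  · refine absurd ?_ (natCast_stepLen_add_ne_zero (n := n) hm l k)
    linear_combination h2 - h1

lemma pair_Cface_odd {m n : ℕ} (j : ZMod (3 ^ m + 2 * n - 1)) (l : Fin m) (t : Fin (2 * m))
    (ht : (t : ℕ) = 2 * l) :
    ({Cface m n j t, Cface m n j (finRotate (2 * m) t)} : Set _) =
      stepPair m n (j + evenOff m n (2 * l + 1), l) := by
  have hr : (finRotate (2 * m) t : ℕ) = 2 * l + 1 := by
    rw [coe_finRotate_eq_mod, ht, Nat.mod_eq_of_lt (by omega)]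
  simp only [Cface, stepPair, hr, ht, evenOff_even]
  push_cast
  rw [add_assoc]

lemma pair_Cface_even {m n : ℕ} (j : ZMod (3 ^ m + 2 * n - 1)) (l : Fin m) (t : Fin (2 * m))
    (ht : (t : ℕ) = 2 * l + 1) :
    ({Cface m n j t, Cface m n j (finRotate (2 * m) t)} : Set _) =
      stepPair m n (j + evenOff m n (2 * l + 2), l) := by
  have key : (evenOff m n ((finRotate (2 * m) t : ℕ) + 1) : ZMod (3 ^ m + 2 * n - 1)) =
      evenOff m n (2 * l + 2) + stepLen m n l := by
    rw [coe_finRotate_eq_mod, ht]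
    rcases Nat.lt_or_ge (l + 1) m with h | h
    · rw [Nat.mod_eq_of_lt (by omega), ← evenOff_even_add_stepLen h]
      push_cast
      rfl
    · obtain ⟨l, hl⟩ := l
      obtain rfl : m = l + 1 := by dsimp only at h; omega
      have h0 := congrArg (Int.cast : ℤ → ZMod (3 ^ (l + 1) + 2 * n - 1))
        (evenOff_last_add_stepLen n l)
      rw [Int.cast_natCast, ZMod.natCast_self, Int.cast_add, Int.cast_natCast] at h0
      rw [h0, show 2 * l + 1 + 1 = 2 * (l + 1) by ring, Nat.mod_self]
      simp [evenOff_odd _ _ 0]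
  simp only [Cface, stepPair, key, ht]
  rw [← add_assoc j]

lemma isCedge_iff {m n : ℕ} (j : ZMod (3 ^ m + 2 * n - 1)) (e : Set (ZMod (3 ^ m + 2 * n - 1))) :
    IsCedge m n j e ↔ ∃ l : Fin m, e = stepPair m n (j + evenOff m n (2 * l + 1), l) ∨
      e = stepPair m n (j + evenOff m n (2 * l + 2), l) := by
  constructor
  · rintro ⟨t, rfl⟩
    refine ⟨⟨t / 2, by omega⟩, ?_⟩
    rcases Nat.mod_two_eq_zero_or_one t with h | h
    · exact Or.inl (pair_Cface_odd j _ t (by dsimp only; omega))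
    · exact Or.inr (pair_Cface_even j _ t (by dsimp only; omega))
  · rintro ⟨l, rfl | rfl⟩
    · exact ⟨⟨2 * l, by omega⟩, (pair_Cface_odd j l _ rfl).symm⟩
    · exact ⟨⟨2 * l + 1, by omega⟩, (pair_Cface_even j l _ rfl).symm⟩

lemma isCedge_stepPair_iff {m n : ℕ} (hm : 3 ≤ m) (j x : ZMod (3 ^ m + 2 * n - 1)) (l : Fin m) :
    IsCedge m n j (stepPair m n (x, l)) ↔
      j = x - evenOff m n (2 * l + 1) ∨ j = x - evenOff m n (2 * l + 2) := by
  simp only [isCedge_iff, (stepPair_injective hm).eq_iff, Prod.mk.injEq, eq_sub_iff_add_eq]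
  constructor
  · rintro ⟨k, ⟨h, rfl⟩ | ⟨h, rfl⟩⟩
    exacts [Or.inl h.symm, Or.inr h.symm]
  · rintro (h | h)
    exacts [⟨l, Or.inl ⟨h.symm, rfl⟩⟩, ⟨l, Or.inr ⟨h.symm, rfl⟩⟩]

lemma card_isCedge_stepPair {m n : ℕ} (hm : 3 ≤ m) (x : ZMod (3 ^ m + 2 * n - 1)) (l : Fin m) :
    Nat.card {j : ZMod (3 ^ m + 2 * n - 1) // IsCedge m n j (stepPair m n (x, l))} = 2 := by
  have hset : {j | IsCedge m n j (stepPair m n (x, l))} =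
      {x - (evenOff m n (2 * l + 1) : ZMod (3 ^ m + 2 * n - 1)),
        x - (evenOff m n (2 * l + 2) : ZMod (3 ^ m + 2 * n - 1))} := by
    ext j
    exact isCedge_stepPair_iff hm j x l
  change Nat.card {j | IsCedge m n j (stepPair m n (x, l))} = 2
  rw [hset, Nat.card_coe_set_eq]
  refine Set.ncard_pair fun h => natCast_stepLen_ne_zero (n := n) hm l ?_
  rw [evenOff_even] at h
  push_cast at h
  linear_combination h

lemma exists_isCedge_iff {m n : ℕ} (hm : 3 ≤ m) (e : Set (ZMod (3 ^ m + 2 * n - 1))) :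
    (∃ j, IsCedge m n j e) ↔ e ∈ Set.range (stepPair m n) := by
  constructor
  · rintro ⟨j, hj⟩
    obtain ⟨l, rfl | rfl⟩ := (isCedge_iff j e).1 hj <;> exact ⟨_, rfl⟩
  · rintro ⟨⟨x, l⟩, rfl⟩
    exact ⟨_, (isCedge_stepPair_iff hm _ x l).2 (Or.inl rfl)⟩

lemma card_edges {m n : ℕ} (hm : 3 ≤ m) :
    Nat.card {e : Set (ZMod (3 ^ m + 2 * n - 1)) // ∃ j, IsCedge m n j e} =
      (3 ^ m + 2 * n - 1) * m := by
  simp only [exists_isCedge_iff hm]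
  refine (Nat.card_range_of_injective (stepPair_injective hm)).trans ?_
  rw [Nat.card_prod, Nat.card_zmod, Nat.card_fin]

/-- for `m ≥ 3`, `n ≥ 0`, `η = 3^m + 2n - 1`: every edge of a face `C_i`
is an edge of exactly two faces `C_j`; the number of distinct edges is `(3^m+2n-1)·m`;
and the Euler characteristic `f_0 - f_1 + f_2` (with `f_0 = f_2 = η`) equals
`(3^m+2n-1)(2-m)`. -/
theorem Cface_edges_and_euler (m n : ℕ) (hm : 3 ≤ m) :
    (∀ e : Set (ZMod (3 ^ m + 2 * n - 1)),
      (∃ j, IsCedge m n j e) →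
      Nat.card {j : ZMod (3 ^ m + 2 * n - 1) // IsCedge m n j e} = 2) ∧
    Nat.card {e : Set (ZMod (3 ^ m + 2 * n - 1)) // ∃ j, IsCedge m n j e} =
      (3 ^ m + 2 * n - 1) * m ∧
    ((3 ^ m + 2 * n - 1 : ℕ) : ℤ) -
        (Nat.card {e : Set (ZMod (3 ^ m + 2 * n - 1)) // ∃ j, IsCedge m n j e} : ℤ) +
        ((3 ^ m + 2 * n - 1 : ℕ) : ℤ) =
      ((3 : ℤ) ^ m + 2 * (n : ℤ) - 1) * (2 - (m : ℤ)) := by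
  refine ⟨fun e he => ?_, card_edges hm, ?_⟩
  · obtain ⟨⟨x, l⟩, rfl⟩ := (exists_isCedge_iff hm e).1 he
    exact card_isCedge_stepPair hm x l
  · have : 1 ≤ 3 ^ m := Nat.one_le_pow _ _ (by norm_num)
    rw [card_edges hm, Nat.cast_mul, Nat.cast_sub (by omega)]
    push_cast
    ring
end

section
/- (Key arithmetic step of Lemma 4, even case.) For all integers m > 3 and n ≥ 0, with η = 3^m + 2n − 1 and b_k as defined: 1 + b_2 − b_{m+3} is not congruent to −b_{m+1} modulo η. (This non-congruence yields the contradiction showing that M_{2m, η} is not combinatorially regular for m > 3.) -/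
theorem bseq_two_mul_add_one (k : ℕ) : bseq (2 * k + 1) = 3 ^ k - 1 := by
  have h : (2 * k + 1) / 2 = k := by lia
  have h' : (2 * k + 1) % 2 = 1 := by lia
  simp [bseq, h, h']

theorem bseq_two_mul_add_two (k : ℕ) : bseq (2 * k + 2) = 2 * 3 ^ k - 1 := by
  simp [bseq]

/-- key arithmetic step of Lemma 4, even case: for `m > 3` and `n ≥ 0`,
with `η = 3^m + 2n - 1`, one has `1 + b_2 - b_{m+3} ≢ -b_{m+1} (mod η)`. -/
theorem even_not_regular_arith (m n : ℕ) (hm : 3 < m) :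
    ¬ (1 + bseq 2 - bseq (m + 3) ≡ -bseq (m + 1)
        [ZMOD ((3 ^ m + 2 * n - 1 : ℕ) : ℤ)]) := by
  intro h
  have hdvd := h.dvd
  have hη : ((3 ^ m + 2 * n - 1 : ℕ) : ℤ) = 3 ^ m + 2 * n - 1 := by
    have : 0 < 3 ^ m := by positivity
    rw [Nat.cast_sub (by lia)]
    push_cast
    ring
  rw [hη, bseq_two_mul_add_two 0] at hdvd
  have hn : (0 : ℤ) ≤ n := n.cast_nonneg
  obtain ⟨k, rfl | rfl⟩ := m.even_or_odd'
  · have hk : (3 : ℤ) ^ 2 ≤ 3 ^ k := pow_le_pow_right₀ (by norm_num) (by lia)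
    rw [bseq_two_mul_add_one k, show 2 * k + 3 = 2 * (k + 1) + 1 by ring,
      bseq_two_mul_add_one (k + 1), pow_mul', pow_succ 3 k] at hdvd
    have := Int.eq_zero_of_abs_lt_dvd hdvd (abs_lt.2 ⟨by nlinarith, by nlinarith⟩)
    linarith
  · have hk : (3 : ℤ) ^ 2 ≤ 3 ^ k := pow_le_pow_right₀ (by norm_num) (by lia)
    rw [show 2 * k + 1 + 1 = 2 * k + 2 by ring, bseq_two_mul_add_two k,
      show 2 * k + 1 + 3 = 2 * (k + 1) + 2 by ring, bseq_two_mul_add_two (k + 1),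
      pow_succ 3 (2 * k), pow_mul', pow_succ 3 k] at hdvd
    have := Int.eq_zero_of_abs_lt_dvd hdvd (abs_lt.2 ⟨by nlinarith, by nlinarith⟩)
    linarith
end

section
/- (Lemma 7(a).) Let p = 4k + 3 be a prime with k ≥ 1, and let σ be the permutation of {1, …, p−1} that interchanges 2j and p − 2j for each 1 ≤ j ≤ k and fixes every other element. Then σ satisfies: (pp1) σ(i) + σ(p−i) = p for all 1 ≤ i ≤ p−1; (pp2) σ((p−1)/2) = (p−1)/2; and (pp3) for every j ∈ {1, …, p−1}, exactly one of the residues j mod p and −j mod p lies in the set {σ(i+1) − σ(i) mod p : 1 ≤ i ≤ (p−1)/2}. -/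
/-- The set of consecutive differences `{π(i+1) - π(i) : 1 ≤ i ≤ (p-1)/2}` taken in `ℤ/pℤ`. -/
def diffSet (p : ℕ) (π : ℕ → ℕ) : Set (ZMod p) :=
  {d | ∃ i, 1 ≤ i ∧ i ≤ (p - 1) / 2 ∧ d = (π (i + 1) : ZMod p) - (π i : ZMod p)}

/-- For `p = 4k+3`, the permutation `σ_p` of `{1, …, p-1}` interchanging `2j` and `p - 2j`
for `1 ≤ j ≤ k` (i.e. swapping each even `x` with `2x < p` with `p - x`) and fixing all
other elements. -/
def ppSigma (p x : ℕ) : ℕ :=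
  if (x % 2 = 0 ∧ 2 * x < p) ∨ ((p - x) % 2 = 0 ∧ 2 * (p - x) < p) then p - x else x

theorem Nat.ModEq.eq_or_eq_add_of_lt {p a b : ℕ} (h : a ≡ b [MOD p]) (ha : a < 2 * p)
    (hb : b < p) : a = b ∨ a = b + p := by
  rw [Nat.ModEq, Nat.mod_eq_of_lt hb] at h
  rcases lt_or_ge a p with hap | hap
  · rw [Nat.mod_eq_of_lt hap] at h
    exact Or.inl h
  · rw [Nat.mod_eq_sub_mod hap, Nat.mod_eq_of_lt (by omega)] at h
    omega

theorem natCast_mem_diffSet_iff {p j : ℕ} {π : ℕ → ℕ} (hj : j < p)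
    (hπ : ∀ i, 1 ≤ i → i < p → π i < p) :
    (j : ZMod p) ∈ diffSet p π ↔
      ∃ i, 1 ≤ i ∧ i ≤ (p - 1) / 2 ∧ (j + π i = π (i + 1) ∨ j + π i = π (i + 1) + p) := by
  refine exists_congr fun i => and_congr_right fun hi => and_congr_right fun hip => ?_
  by_cases hp : p ≤ 2
  · omega
  have h1 := hπ i hi (by omega)
  have h2 := hπ (i + 1) (by omega) (by omega)
  rw [eq_sub_iff_add_eq]
  constructor
  · intro h
    have h' : ((j + π i : ℕ) : ZMod p) = (π (i + 1) : ℕ) := by exact_mod_cast h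
    exact ((ZMod.natCast_eq_natCast_iff _ _ _).1 h').eq_or_eq_add_of_lt (by omega) h2
  · rintro (h | h)
    · exact_mod_cast congrArg (Nat.cast : ℕ → ZMod p) h
    · simpa using congrArg (Nat.cast : ℕ → ZMod p) h

/-- Modulo `p = 4k + 3`, the differences of `σ_p` are the residues of the `j < p` that are
`0` or `1` modulo `4`. -/
theorem natCast_mem_diffSet_ppSigma_iff {p k j : ℕ} (hp : p = 4 * k + 3) (hj1 : 1 ≤ j)
    (hj : j < p) : (j : ZMod p) ∈ diffSet p (ppSigma p) ↔ j % 4 < 2 := by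
  rw [natCast_mem_diffSet_iff hj (fun i _ _ => by unfold ppSigma; split_ifs <;> omega)]
  constructor
  · rintro ⟨i, h1, h2, h⟩
    unfold ppSigma at h
    split_ifs at h <;> omega
  · intro h
    by_cases hone : j = 1
    · refine ⟨2 * k + 1, by omega, by omega, ?_⟩
      unfold ppSigma
      split_ifs <;> omega
    by_cases hodd : j % 4 = 1
    · refine ⟨(j - 1) / 2, by omega, by omega, ?_⟩
      unfold ppSigma
      split_ifs <;> omega
    · refine ⟨(p - j - 1) / 2, by omega, by omega, ?_⟩
      unfold ppSigma
      split_ifs <;> omega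

/-- Lemma 7(a): for a prime `p = 4k + 3` with `k ≥ 1`, the permutation
`σ_p = (2, p-2)(4, p-4)⋯(2k, 2k+3)` satisfies
(pp1) `σ(i) + σ(p-i) = p` for `1 ≤ i ≤ p-1`;
(pp2) `σ((p-1)/2) = (p-1)/2`;
(pp3) for every `1 ≤ j ≤ p-1`, exactly one of `j mod p` and `-j mod p` lies in the set of
consecutive differences `{σ(i+1) - σ(i) mod p : 1 ≤ i ≤ (p-1)/2}`. -/
theorem ppSigma_satisfies_pp (p k : ℕ) (hk : 1 ≤ k) (hp : p = 4 * k + 3)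
    (hprime : p.Prime) :
    (∀ i, 1 ≤ i → i ≤ p - 1 → ppSigma p i + ppSigma p (p - i) = p) ∧
    ppSigma p ((p - 1) / 2) = (p - 1) / 2 ∧
    (∀ j, 1 ≤ j → j ≤ p - 1 →
      Xor' (((j : ZMod p)) ∈ diffSet p (ppSigma p))
           ((-(j : ZMod p)) ∈ diffSet p (ppSigma p))) := by
  refine ⟨fun i h1 h2 => ?_, ?_, fun j h1 h2 => ?_⟩
  · unfold ppSigma
    split_ifs <;> omega
  · unfold ppSigma
    split_ifs <;> omega
  · have hneg : (-(j : ZMod p)) = ((p - j : ℕ) : ZMod p) := by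
      rw [Nat.cast_sub (by omega)]
      simp
    rw [hneg, natCast_mem_diffSet_ppSigma_iff hp h1 (by omega),
      natCast_mem_diffSet_ppSigma_iff hp (by omega) (by omega)]
    change Xor _ _
    rw [xor_iff_not_iff]
    omega
end

section
/- (Lemma 7(b).) Let p = 4l + 1 be a prime with l ≥ 1, and let ρ be the permutation of {1, …, p−1} that interchanges 2j − 1 and p − (2j − 1) for each 1 ≤ j ≤ l and fixes every other element. Then ρ satisfies: (pp1) ρ(i) + ρ(p−i) = p for all 1 ≤ i ≤ p−1; (pp2) ρ((p−1)/2) = (p−1)/2; and (pp3) for every j ∈ {1, …, p−1}, exactly one of the residues j mod p and −j mod p lies in the set {ρ(i+1) − ρ(i) mod p : 1 ≤ i ≤ (p−1)/2}. -/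
/-- For `p = 4l+1`, the permutation `ρ_p` of `{1, …, p-1}` interchanging `2j - 1` and
`p - (2j - 1)` for `1 ≤ j ≤ l` (i.e. swapping each odd `x` with `2x < p` with `p - x`)
and fixing all other elements. -/
def ppRho (p x : ℕ) : ℕ :=
  if (x % 2 = 1 ∧ 2 * x < p) ∨ ((p - x) % 2 = 1 ∧ 2 * (p - x) < p) then p - x else x

theorem ZMod.natCast_eq_natCast_sub_natCast_iff {n d a b : ℕ} (hd : d < n) (ha : a < n)
    (hb : b < n) : (d : ZMod n) = (b : ZMod n) - (a : ZMod n) ↔ d + a = b ∨ d + a = b + n := by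
  rw [eq_sub_iff_add_eq, ← Nat.cast_add, ZMod.natCast_eq_natCast_iff']
  rw [Nat.mod_eq_of_lt hb]
  rcases lt_or_ge (d + a) n with h | h
  · rw [Nat.mod_eq_of_lt h]
    omega
  · rw [Nat.mod_eq_sub_mod h, Nat.mod_eq_of_lt (by omega)]
    omega

theorem natCast_mem_diffSet_ppRho_iff {l d : ℕ} (hd : 1 ≤ d) (hdl : d ≤ 4 * l) :
    (d : ZMod (4 * l + 1)) ∈ diffSet (4 * l + 1) (ppRho (4 * l + 1)) ↔
      d % 4 = 3 ∨ (d % 4 = 0 ∧ d < 4 * l) ∨ d = 1 := by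
  have hlt : ∀ x, 1 ≤ x → x ≤ 4 * l → ppRho (4 * l + 1) x < 4 * l + 1 := by
    intro x h1 h2
    unfold ppRho
    split_ifs <;> omega
  have hmem : (d : ZMod (4 * l + 1)) ∈ diffSet (4 * l + 1) (ppRho (4 * l + 1)) ↔
      ∃ i, 1 ≤ i ∧ i ≤ 2 * l ∧
        (d + ppRho (4 * l + 1) i = ppRho (4 * l + 1) (i + 1) ∨
          d + ppRho (4 * l + 1) i = ppRho (4 * l + 1) (i + 1) + (4 * l + 1)) := by
    rw [diffSet, Set.mem_ofPred_eq]
    refine exists_congr fun i => and_congr_right fun h1 => ?_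
    rw [show (4 * l + 1 - 1) / 2 = 2 * l by omega]
    refine and_congr_right fun h2 => ?_
    exact ZMod.natCast_eq_natCast_sub_natCast_iff (by omega) (hlt i h1 (by omega))
      (hlt (i + 1) (by omega) (by omega))
  rw [hmem]
  constructor
  · rintro ⟨i, h1, h2, h⟩
    unfold ppRho at h
    split_ifs at h <;> omega
  · rintro (h | ⟨h, h'⟩ | h)
    · refine ⟨d / 2, by omega, by omega, ?_⟩
      unfold ppRho
      split_ifs <;> omega
    · refine ⟨(4 * l - d) / 2, by omega, by omega, ?_⟩
      unfold ppRho
      split_ifs <;> omega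
    · refine ⟨2 * l, by omega, by omega, ?_⟩
      unfold ppRho
      split_ifs <;> omega

/-- Lemma 7(b): for a prime `p = 4l + 1` with `l ≥ 1`, the permutation
`ρ_p = (1, p-1)(3, p-3)⋯(2l-1, 2l+2)` satisfies
(pp1) `ρ(i) + ρ(p-i) = p` for `1 ≤ i ≤ p-1`;
(pp2) `ρ((p-1)/2) = (p-1)/2`;
(pp3) for every `1 ≤ j ≤ p-1`, exactly one of `j mod p` and `-j mod p` lies in the set of
consecutive differences `{ρ(i+1) - ρ(i) mod p : 1 ≤ i ≤ (p-1)/2}`. -/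
theorem ppRho_satisfies_pp (p l : ℕ) (hl : 1 ≤ l) (hp : p = 4 * l + 1)
    (hprime : p.Prime) :
    (∀ i, 1 ≤ i → i ≤ p - 1 → ppRho p i + ppRho p (p - i) = p) ∧
    ppRho p ((p - 1) / 2) = (p - 1) / 2 ∧
    (∀ j, 1 ≤ j → j ≤ p - 1 →
      Xor' (((j : ZMod p)) ∈ diffSet p (ppRho p))
           ((-(j : ZMod p)) ∈ diffSet p (ppRho p))) := by
  subst hp
  refine ⟨fun i h1 h2 => ?_, ?_, fun j h1 h2 => ?_⟩
  · unfold ppRho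
    split_ifs <;> omega
  · unfold ppRho
    split_ifs <;> omega
  · have hneg : -(j : ZMod (4 * l + 1)) = ((4 * l + 1 - j : ℕ) : ZMod (4 * l + 1)) := by
      rw [Nat.cast_sub (by omega), ZMod.natCast_self, zero_sub]
    rw [hneg, natCast_mem_diffSet_ppRho_iff h1 (by omega),
      natCast_mem_diffSet_ppRho_iff (by omega) (by omega)]
    refine xor_def.mpr ?_
    omega
end

section
/- (Intermediate claims in the proof of Lemma 5.) Let p be an odd prime and let π be a permutation of {1, …, p−1} satisfying (pp1), (pp2) and (pp3). For 1 ≤ i ≤ p−2 set a_i = π(i+1) − π(i), regarded as an element of ℤ/pℤ. Then: (i) a_i = a_{p−1−i} for all 1 ≤ i ≤ p−2; (ii) a_{(p−1)/2} = 1; and (iii) the set {a_1, …, a_{(p−1)/2}} ∪ {−a_1, …, −a_{(p−1)/2}} equals ℤ/pℤ ∖ {0}. -/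
/-- intermediate claims in the proof of Lemma 5: let `p` be an odd prime
and `π` a permutation of `{1, …, p-1}` satisfying (pp1), (pp2), (pp3). Setting
`a_i = π(i+1) - π(i) ∈ ℤ/pℤ` for `1 ≤ i ≤ p-2`:
(i) `a_i = a_{p-1-i}`; (ii) `a_{(p-1)/2} = 1`;
(iii) `{a_1, …, a_{(p-1)/2}} ∪ {-a_1, …, -a_{(p-1)/2}} = ℤ/pℤ ∖ {0}`. -/
theorem pp_perm_diffs (p : ℕ) (hp : p.Prime) (hodd : Odd p) (π : ℕ → ℕ)
    (hperm : Set.BijOn π (Set.Icc 1 (p - 1)) (Set.Icc 1 (p - 1)))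
    (pp1 : ∀ i, 1 ≤ i → i ≤ p - 1 → π i + π (p - i) = p)
    (pp2 : π ((p - 1) / 2) = (p - 1) / 2)
    (pp3 : ∀ j, 1 ≤ j → j ≤ p - 1 →
      Xor' (((j : ZMod p)) ∈ diffSet p π) ((-(j : ZMod p)) ∈ diffSet p π)) :
    (∀ i, 1 ≤ i → i ≤ p - 2 →
      (π (i + 1) : ZMod p) - (π i : ZMod p) =
        (π (p - 1 - i + 1) : ZMod p) - (π (p - 1 - i) : ZMod p)) ∧
    (π ((p - 1) / 2 + 1) : ZMod p) - (π ((p - 1) / 2) : ZMod p) = 1 ∧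
    {x : ZMod p | ∃ i, 1 ≤ i ∧ i ≤ (p - 1) / 2 ∧
        (x = (π (i + 1) : ZMod p) - (π i : ZMod p) ∨
         x = -((π (i + 1) : ZMod p) - (π i : ZMod p)))} =
      {x : ZMod p | x ≠ 0} := by
  have hp2 := hp.two_le
  obtain ⟨m, hm⟩ := hodd
  have hhalf : (p - 1) / 2 = m := by omega
  have : Fact p.Prime := ⟨hp⟩
  have hcast : ∀ i, 1 ≤ i → i ≤ p - 1 → (π i : ZMod p) + π (p - i) = 0 := by
    intro i h1 h2
    rw [← Nat.cast_add, pp1 i h1 h2, ZMod.natCast_self]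
  refine ⟨?_, ?_, ?_⟩
  · intro i h1 h2
    have e1 := hcast i h1 (by omega)
    have e2 := hcast (i + 1) (by omega) (by omega)
    rw [show p - 1 - i + 1 = p - i by omega, show p - 1 - i = p - (i + 1) by omega]
    linear_combination e2 - e1
  · rw [hhalf] at pp2 ⊢
    have h := pp1 m (by omega) (by omega)
    rw [show p - m = m + 1 by omega] at h
    rw [pp2, show π (m + 1) = m + 1 by omega]
    push_cast
    ring
  · have hne : ∀ i, 1 ≤ i → i ≤ (p - 1) / 2 → (π (i + 1) : ZMod p) - (π i : ZMod p) ≠ 0 := by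
      intro i h1 h2 h
      have hi : i ∈ Set.Icc 1 (p - 1) := ⟨h1, by omega⟩
      have hi' : i + 1 ∈ Set.Icc 1 (p - 1) := ⟨by omega, by omega⟩
      obtain ⟨-, hlt⟩ := hperm.mapsTo hi
      obtain ⟨-, hlt'⟩ := hperm.mapsTo hi'
      have hmod := (ZMod.natCast_eq_natCast_iff _ _ _).1 (sub_eq_zero.1 h)
      have := hperm.injOn hi' hi (hmod.eq_of_lt_of_lt (by omega) (by omega))
      omega
    ext x
    constructor
    · rintro ⟨i, h1, h2, rfl | rfl⟩
      · exact hne i h1 h2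
      · exact neg_ne_zero.2 (hne i h1 h2)
    · intro hx
      have hval : x.val ≠ 0 := fun h => hx ((ZMod.val_eq_zero x).1 h)
      have hlt := ZMod.val_lt x
      have h := pp3 x.val (by omega) (by omega)
      rw [ZMod.natCast_zmod_val] at h
      obtain ⟨⟨i, h1, h2, h3⟩, -⟩ | ⟨⟨i, h1, h2, h3⟩, -⟩ := h
      · exact ⟨i, h1, h2, Or.inl h3⟩
      · exact ⟨i, h1, h2, Or.inr (by rw [← h3, neg_neg])⟩
end

section
/- (Manifold property of the pattern of Lemma 5.) Let p be an odd prime, let π be a permutation of {1, …, p−1} satisfying (pp1), (pp2) and (pp3), and let u be an extra symbol not in ℤ/pℤ. On the vertex set ℤ/pℤ ∪ {u}, consider the p+1 cycles: the cycle C = (0, 1, …, p−1), and for each i ∈ ℤ/pℤ the cycle C_i = (u, i+π(1), i+π(2), …, i+π(p−1)); the edges of a cycle are the 2-element sets of cyclically consecutive entries. Then every 2-element subset of ℤ/pℤ ∪ {u} occurs as an edge of exactly two of these p+1 cycles. -/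
/-- The entries of the `p + 1` cycles of the collection `C(π)` on the vertex set
`ℤ/pℤ ∪ {u}` (realized as `Option (ZMod p)`, where `u = none`): the cycle indexed by
`none` is `C = (0, 1, …, p-1)`, and the cycle indexed by `some i` is
`C_i = (u, i + π(1), i + π(2), …, i + π(p-1))`. -/
def cycEnt (p : ℕ) (π : ℕ → ℕ) (c : Option (ZMod p)) (t : Fin p) : Option (ZMod p) :=
  match c with
  | none => some ((t.1 : ZMod p))
  | some i => if t.1 = 0 then none else some (i + (π t.1 : ZMod p))

theorem val_finRotate (p : ℕ) (t : Fin p) :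
    (finRotate p t).1 = if t.1 + 1 = p then 0 else t.1 + 1 := by
  cases p with
  | zero => exact t.elim0
  | succ n =>
    by_cases h : t = Fin.last n
    · subst h
      simp
    · rw [coe_finRotate_of_ne_last h, if_neg]
      intro h'
      exact h (Fin.ext (by simpa using h'))

theorem exists_edge_none_iff {p : ℕ} (hp : 3 ≤ p) (π : ℕ → ℕ) (x y : ZMod p) :
    (∃ t : Fin p, ({some x, some y} : Set (Option (ZMod p))) =
      {cycEnt p π none t, cycEnt p π none (finRotate p t)}) ↔ y - x = 1 ∨ x - y = 1 := by
  have hrot : ∀ t : Fin p, (((finRotate p t).1 : ℕ) : ZMod p) = (t.1 : ZMod p) + 1 := by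
    intro t
    rw [val_finRotate]
    split_ifs with h
    · rw [← Nat.cast_succ, Nat.succ_eq_add_one, h]
      simp
    · push_cast
      rfl
  have : NeZero p := ⟨by omega⟩
  simp only [cycEnt, Set.pair_eq_pair_iff, Option.some.injEq, hrot]
  constructor
  · rintro ⟨t, ⟨rfl, rfl⟩ | ⟨rfl, rfl⟩⟩ <;> simp
  · rintro (h | h)
    · refine ⟨⟨x.val, x.val_lt⟩, Or.inl ⟨by simp, ?_⟩⟩
      simp [← h]
    · refine ⟨⟨y.val, y.val_lt⟩, Or.inr ⟨?_, by simp⟩⟩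
      simp [← h]

theorem exists_edge_some_iff {p : ℕ} (π : ℕ → ℕ) (i x y : ZMod p) :
    (∃ t : Fin p, ({some x, some y} : Set (Option (ZMod p))) =
      {cycEnt p π (some i) t, cycEnt p π (some i) (finRotate p t)}) ↔
    ∃ t, 1 ≤ t ∧ t + 1 < p ∧ ((x = i + π t ∧ y = i + π (t + 1)) ∨
      (x = i + π (t + 1) ∧ y = i + π t)) := by
  simp only [cycEnt, Set.pair_eq_pair_iff, val_finRotate]
  constructor
  · rintro ⟨t, h⟩
    have ht := t.2
    have h0 : t.1 ≠ 0 := fun h0 => by simp [h0] at h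
    have h1 : t.1 + 1 ≠ p := fun h1 => by simp [h1] at h
    exact ⟨t.1, by omega, by omega, by simpa [h0, h1] using h⟩
  · rintro ⟨t, h1, h2, h⟩
    refine ⟨⟨t, by omega⟩, ?_⟩
    simpa [show t ≠ 0 by omega, show t + 1 ≠ p by omega] using h

theorem exists_apex_edge_iff {p : ℕ} (hp : 3 ≤ p) (π : ℕ → ℕ) (i x : ZMod p) :
    (∃ t : Fin p, ({none, some x} : Set (Option (ZMod p))) =
      {cycEnt p π (some i) t, cycEnt p π (some i) (finRotate p t)}) ↔
    x = i + π 1 ∨ x = i + π (p - 1) := by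
  simp only [cycEnt, Set.pair_eq_pair_iff, val_finRotate]
  constructor
  · rintro ⟨t, h⟩
    have ht := t.2
    by_cases h0 : t.1 = 0
    · left
      simpa [h0, show 1 ≠ p by omega] using h
    · by_cases h1 : t.1 + 1 = p
      · right
        simpa [show t.1 = p - 1 by omega, show p - 1 ≠ 0 by omega,
          show p - 1 + 1 = p by omega] using h
      · simp [h0, h1] at h
  · rintro (h | h)
    · exact ⟨⟨0, by omega⟩, by simp [show 1 ≠ p by omega, h]⟩
    · refine ⟨⟨p - 1, by omega⟩, ?_⟩
      simp [show p - 1 ≠ 0 by omega, show p - 1 + 1 = p by omega, h]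

theorem injOn_diff_of_xor {p : ℕ} [Fact p.Prime] (π : ℕ → ℕ)
    (h : ∀ d : ZMod p, d ≠ 0 → Xor (d ∈ diffSet p π) (-d ∈ diffSet p π)) (hodd : Odd p) :
    Set.InjOn (fun t => (π (t + 1) : ZMod p) - π t) (Set.Icc 1 ((p - 1) / 2)) := by
  classical
  set D : ℕ → ZMod p := fun t => (π (t + 1) : ZMod p) - π t
  set S := (Finset.Icc 1 ((p - 1) / 2)).image D
  have hS : ∀ d, d ∈ diffSet p π ↔ d ∈ S := by
    intro d
    simp only [diffSet, Set.mem_ofPred_eq, S, Finset.mem_image, Finset.mem_Icc, D]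
    constructor
    · rintro ⟨t, h1, h2, h3⟩
      exact ⟨t, ⟨h1, h2⟩, h3.symm⟩
    · rintro ⟨t, ⟨h1, h2⟩, h3⟩
      exact ⟨t, h1, h2, h3.symm⟩
  have hsub : (Finset.univ.erase (0 : ZMod p)) ⊆ S ∪ S.image (fun d => -d) := by
    intro d hd
    rcases h d (Finset.ne_of_mem_erase hd) with ⟨h1, _⟩ | ⟨h1, _⟩
    · exact Finset.mem_union_left _ ((hS d).1 h1)
    · exact Finset.mem_union_right _ (Finset.mem_image.2 ⟨-d, (hS _).1 h1, neg_neg d⟩)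
  have hcard := (Finset.card_le_card hsub).trans (Finset.card_union_le _ _)
  rw [Finset.card_erase_of_mem (Finset.mem_univ _), Finset.card_univ, ZMod.card] at hcard
  have h1 : (S.image (fun d => -d)).card ≤ S.card := Finset.card_image_le
  have h2 : S.card ≤ (Finset.Icc 1 ((p - 1) / 2)).card := Finset.card_image_le
  have h3 : S.card = (Finset.Icc 1 ((p - 1) / 2)).card := by
    rw [Nat.card_Icc] at h2 ⊢
    obtain ⟨k, rfl⟩ := hodd
    omega
  simpa using Finset.card_image_iff.1 h3

theorem natCast_injOn_Icc (p : ℕ) :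
    Set.InjOn (fun n : ℕ => (n : ZMod p)) (Set.Icc 1 (p - 1)) := by
  rintro a ⟨ha, ha'⟩ b ⟨hb, hb'⟩ hab
  have := (ZMod.natCast_eq_natCast_iff' a b p).1 hab
  rwa [Nat.mod_eq_of_lt (by omega), Nat.mod_eq_of_lt (by omega)] at this

section

variable {p : ℕ} [Fact p.Prime] {π : ℕ → ℕ}

theorem diff_reflect (pp1 : ∀ i, 1 ≤ i → i ≤ p - 1 → π i + π (p - i) = p) {t : ℕ}
    (h1 : 1 ≤ t) (h2 : t + 1 < p) :
    (π (p - 1 - t + 1) : ZMod p) - π (p - 1 - t) = (π (t + 1) : ZMod p) - π t := by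
  have ha := congrArg (Nat.cast : ℕ → ZMod p) (pp1 t h1 (by omega))
  have hb := congrArg (Nat.cast : ℕ → ZMod p) (pp1 (t + 1) (by omega) (by omega))
  rw [show p - 1 - t + 1 = p - t by omega, show p - 1 - t = p - (t + 1) by omega]
  push_cast at ha hb
  linear_combination ha - hb

theorem exists_half_diff_eq (pp1 : ∀ i, 1 ≤ i → i ≤ p - 1 → π i + π (p - i) = p)
    (hodd : Odd p) {t : ℕ} (h1 : 1 ≤ t) (h2 : t + 1 < p) :
    ∃ s, 1 ≤ s ∧ s ≤ (p - 1) / 2 ∧ (t = s ∨ t = p - 1 - s) ∧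
      (π (s + 1) : ZMod p) - π s = (π (t + 1) : ZMod p) - π t := by
  obtain ⟨k, hk⟩ := hodd
  by_cases h : t ≤ (p - 1) / 2
  · exact ⟨t, h1, h, Or.inl rfl, rfl⟩
  · exact ⟨p - 1 - t, by omega, by omega, by omega, diff_reflect pp1 h1 h2⟩

theorem ncard_cycles_of_diff_eq (hodd : Odd p)
    (hinj : Set.InjOn (fun t => (π t : ZMod p)) (Set.Icc 1 (p - 1)))
    (pp1 : ∀ i, 1 ≤ i → i ≤ p - 1 → π i + π (p - i) = p)
    (pp2 : π ((p - 1) / 2) = (p - 1) / 2)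
    (hxor : ∀ d : ZMod p, d ≠ 0 → Xor (d ∈ diffSet p π) (-d ∈ diffSet p π))
    {x y : ZMod p} (hxy : x ≠ y) (hd : y - x ∈ diffSet p π) :
    {c : Option (ZMod p) | ∃ t : Fin p, ({some x, some y} : Set (Option (ZMod p))) =
      {cycEnt p π c t, cycEnt p π c (finRotate p t)}}.ncard = 2 := by
  have hp : 3 ≤ p := by
    have := (Fact.out : p.Prime).two_le
    obtain ⟨k, rfl⟩ := hodd
    omega
  have hD := injOn_diff_of_xor π hxor hodd
  have hneg : x - y ∉ diffSet p π := by
    intro h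
    rw [← neg_sub y x] at h
    rcases hxor _ (sub_ne_zero.2 hxy.symm) with ⟨_, h'⟩ | ⟨_, h'⟩
    exacts [h' h, h' hd]
  obtain ⟨s, hs1, hs2, hs⟩ := hd
  obtain ⟨k, hk⟩ := id hodd
  have hmid : (π ((p - 1) / 2 + 1) : ZMod p) - π ((p - 1) / 2) = 1 := by
    have h := congrArg (Nat.cast : ℕ → ZMod p) (pp1 ((p - 1) / 2) (by omega) (by omega))
    rw [show p - (p - 1) / 2 = (p - 1) / 2 + 1 by omega, pp2] at h
    have h' : ((2 * ((p - 1) / 2) + 1 : ℕ) : ZMod p) = 0 := by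
      rw [show 2 * ((p - 1) / 2) + 1 = p by omega]
      simp
    rw [pp2]
    push_cast at h h'
    rw [ZMod.natCast_self] at h
    linear_combination h - h'
  have hnone : (∃ t : Fin p, ({some x, some y} : Set (Option (ZMod p))) =
      {cycEnt p π none t, cycEnt p π none (finRotate p t)}) ↔ s = (p - 1) / 2 := by
    rw [exists_edge_none_iff hp]
    constructor
    · rintro (h | h)
      · exact hD ⟨hs1, hs2⟩ ⟨by omega, le_rfl⟩ (by simp only [hmid, ← hs, h])
      · exact (hneg ⟨(p - 1) / 2, by omega, le_rfl, by rw [hmid, h]⟩).elim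
    · rintro rfl
      exact Or.inl (hs.trans hmid)
  have hsome : ∀ i : ZMod p, (∃ t : Fin p, ({some x, some y} : Set (Option (ZMod p))) =
      {cycEnt p π (some i) t, cycEnt p π (some i) (finRotate p t)}) ↔
      i = x - π s ∨ i = x - π (p - 1 - s) := by
    intro i
    rw [exists_edge_some_iff]
    constructor
    · rintro ⟨t, h1, h2, h⟩
      obtain ⟨r, hr1, hr2, hrt, hr⟩ := exists_half_diff_eq pp1 hodd h1 h2
      rcases h with ⟨hx, hy⟩ | ⟨hx, hy⟩
      · have hrs : r = s := hD ⟨hr1, hr2⟩ ⟨hs1, hs2⟩ (by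
          simp only [hr, ← hs, hx, hy]
          ring)
        subst hrs
        rcases hrt with rfl | rfl
        · left
          rw [hx]
          ring
        · right
          rw [hx]
          ring
      · exact (hneg ⟨r, hr1, hr2, by rw [hr, hx, hy]; ring⟩).elim
    · rintro (h | h)
      · refine ⟨s, hs1, by omega, Or.inl ⟨by rw [h]; ring, ?_⟩⟩
        rw [h]
        linear_combination hs
      · refine ⟨p - 1 - s, by omega, by omega, Or.inl ⟨by rw [h]; ring, ?_⟩⟩
        rw [h]
        linear_combination hs - diff_reflect pp1 hs1 (show s + 1 < p by omega)
  rw [Set.ncard_eq_two]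
  by_cases hsm : s = (p - 1) / 2
  · refine ⟨none, some (x - π s), by simp, ?_⟩
    ext (_ | i)
    · simpa only [Set.mem_ofPred_eq, Set.mem_insert_iff, true_or, iff_true] using hnone.2 hsm
    · rw [Set.mem_ofPred_eq, hsome, show p - 1 - s = s by omega]
      simp
  · refine ⟨some (x - π s), some (x - π (p - 1 - s)), ?_, ?_⟩
    · intro h
      have := hinj (x₁ := s) (x₂ := p - 1 - s) ⟨hs1, by omega⟩ ⟨by omega, by omega⟩
        (sub_right_injective (Option.some.inj h))
      omega
    · ext (_ | i)
      · rw [Set.mem_ofPred_eq, hnone]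
        simp [hsm]
      · rw [Set.mem_ofPred_eq, hsome]
        simp

theorem ncard_cycles_apex (hp : 3 ≤ p)
    (hinj : Set.InjOn (fun t => (π t : ZMod p)) (Set.Icc 1 (p - 1))) (x : ZMod p) :
    {c : Option (ZMod p) | ∃ t : Fin p, ({none, some x} : Set (Option (ZMod p))) =
      {cycEnt p π c t, cycEnt p π c (finRotate p t)}}.ncard = 2 := by
  refine Set.ncard_eq_two.2 ⟨some (x - π 1), some (x - π (p - 1)), ?_, ?_⟩
  · intro h
    have := hinj (x₁ := 1) (x₂ := p - 1) ⟨le_rfl, by omega⟩ ⟨by omega, le_rfl⟩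
      (sub_right_injective (Option.some.inj h))
    omega
  · ext (_ | i)
    · simp [cycEnt, Set.pair_eq_pair_iff]
    · rw [Set.mem_ofPred_eq, exists_apex_edge_iff hp]
      simp [eq_sub_iff_add_eq, eq_comm]

end


/-- manifold property of the pattern of Lemma 5: let `p` be an odd prime
and `π` a permutation of `{1, …, p-1}` satisfying (pp1), (pp2), (pp3). Then every
2-element subset of `ℤ/pℤ ∪ {u}` occurs as an edge (a set of two cyclically consecutive
entries) of exactly two of the `p + 1` cycles of `C(π)`. -/
theorem cyc_edges_in_exactly_two (p : ℕ) (hp : p.Prime) (hodd : Odd p) (π : ℕ → ℕ)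
    (hperm : Set.BijOn π (Set.Icc 1 (p - 1)) (Set.Icc 1 (p - 1)))
    (pp1 : ∀ i, 1 ≤ i → i ≤ p - 1 → π i + π (p - i) = p)
    (pp2 : π ((p - 1) / 2) = (p - 1) / 2)
    (pp3 : ∀ j, 1 ≤ j → j ≤ p - 1 →
      Xor' (((j : ZMod p)) ∈ diffSet p π) ((-(j : ZMod p)) ∈ diffSet p π)) :
    ∀ e : Set (Option (ZMod p)), e.ncard = 2 →
      Nat.card {c : Option (ZMod p) //
        ∃ t : Fin p, e = {cycEnt p π c t, cycEnt p π c (finRotate p t)}} = 2 := by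
  intro e he
  have : Fact p.Prime := ⟨hp⟩
  have hp3 : 3 ≤ p := by
    have := hp.two_le
    obtain ⟨k, rfl⟩ := hodd
    omega
  have hinj : Set.InjOn (fun t => (π t : ZMod p)) (Set.Icc 1 (p - 1)) :=
    (natCast_injOn_Icc p).comp hperm.injOn hperm.mapsTo
  have hxor : ∀ d : ZMod p, d ≠ 0 → Xor (d ∈ diffSet p π) (-d ∈ diffSet p π) := by
    intro d hd
    have hpos := ZMod.val_pos.2 hd
    have hlt := d.val_lt
    have h := pp3 d.val (by omega) (by omega)
    rw [ZMod.natCast_zmod_val] at h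
    exact h
  change Set.ncard {c : Option (ZMod p) | ∃ t : Fin p,
    e = {cycEnt p π c t, cycEnt p π c (finRotate p t)}} = 2
  obtain ⟨a, b, hab, rfl⟩ := Set.ncard_eq_two.1 he
  rcases a with _ | x <;> rcases b with _ | y
  · exact (hab rfl).elim
  · exact ncard_cycles_apex hp3 hinj y
  · rw [Set.pair_comm]
    exact ncard_cycles_apex hp3 hinj x
  · have hxy : x ≠ y := fun h => hab (congrArg some h)
    rcases hxor (y - x) (sub_ne_zero.2 hxy.symm) with ⟨h, _⟩ | ⟨h, _⟩
    · exact ncard_cycles_of_diff_eq hodd hinj pp1 pp2 hxor hxy h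
    · rw [neg_sub] at h
      rw [Set.pair_comm]
      exact ncard_cycles_of_diff_eq hodd hinj pp1 pp2 hxor hxy.symm h
end
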